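/- Let D be a minimal counterexample, C its Hamilton cycle with the stated domination property, and x a vertex of D incident with no green edges such that the edge between x^- and x is red (directed from x^- to x). Then the sets R_r^+(x) and R_r^-(x) are both nonempty; moreover, there is a vertex in R_r^-(x) whose successor on C does not lie in B^+(x). -/

import Mathlib

/-- A 3-coloured tournament on vertex type `V`: between any two distinct
vertices there is exactly one directed edge (`beats`), and `colour x y` gives
the colour (one of three: red, blue, green) of the edge from `x` to `y`
(meaningful when `beats x y` holds). -/
structure CTournament (V : Type*) where
  beats : V → V → Prop
  irrefl : ∀ v, ¬ beats v v
  asymm : ∀ v w, beats v w → ¬ beats w v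
  total : ∀ v w, v ≠ w → beats v w ∨ beats w v
  colour : V → V → Fin 3

namespace CTournament

/-- The colour red. -/
def red : Fin 3 := 0
/-- The colour blue. -/
def blue : Fin 3 := 1
/-- The colour green. -/
def green : Fin 3 := 2

variable {V : Type*} (T : CTournament V)

/-- `x` monochromatically dominates `y` in colour `c`: there is a directed
path (with at least one edge) from `x` to `y` all of whose edges have
colour `c`. -/
def Dom (c : Fin 3) (x y : V) : Prop :=
  Relation.TransGen (fun a b => T.beats a b ∧ T.colour a b = c) x y

/-- `x` monochromatically dominates `y` (in some colour). -/
def MDom (x y : V) : Prop := ∃ c, T.Dom c x y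

/-- `x` monochromatically dominates `y` in colour `c` within the
subtournament induced on the vertex set `S`. -/
def DomIn (S : Set V) (c : Fin 3) (x y : V) : Prop :=
  Relation.TransGen (fun a b => a ∈ S ∧ b ∈ S ∧ T.beats a b ∧ T.colour a b = c) x y

/-- `x` monochromatically dominates `y` within the subtournament induced on `S`. -/
def MDomIn (S : Set V) (x y : V) : Prop := ∃ c, T.DomIn S c x y

/-- `T` contains a `T_3`: three vertices spanning a cyclic triangle whose
three edges have three pairwise distinct colours. -/
def HasT3 : Prop :=
  ∃ a b c : V, T.beats a b ∧ T.beats b c ∧ T.beats c a ∧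
    T.colour a b ≠ T.colour b c ∧ T.colour b c ≠ T.colour c a ∧
    T.colour a b ≠ T.colour c a

/-- Vertex `v` is incident with an edge of colour `c`. -/
def IncidentColour (v : V) (c : Fin 3) : Prop :=
  ∃ w, (T.beats v w ∧ T.colour v w = c) ∨ (T.beats w v ∧ T.colour w v = c)

/-- `T` is a minimal counterexample: it contains no `T_3`, no vertex
monochromatically dominates every other vertex, and every proper nonempty
subset of the vertices spans a subtournament containing a vertex that
monochromatically dominates (within that subtournament) every other vertex
of the subset. -/
def MinimalCex : Prop :=
  ¬ T.HasT3 ∧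
  (¬ ∃ x : V, ∀ y, y ≠ x → T.MDom x y) ∧
  ∀ S : Set V, S.Nonempty → S ≠ Set.univ →
    ∃ x ∈ S, ∀ y ∈ S, y ≠ x → T.MDomIn S x y

/-- The permutation `σ` (sending every vertex to its successor) is a directed
Hamilton cycle of `T`: every vertex beats its successor, and all vertices lie
on a single cycle of `σ`. -/
def IsHamCycle (σ : Equiv.Perm V) : Prop :=
  (∀ v, T.beats v (σ v)) ∧ ∀ v w : V, ∃ n : ℕ, (⇑σ)^[n] v = w

/-- The domination property of the Hamilton cycle `σ`: every vertex
monochromatically dominates every vertex other than itself and its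
predecessor on the cycle, and no vertex monochromatically dominates its
predecessor. -/
def HamDomProp (σ : Equiv.Perm V) : Prop :=
  (∀ x y : V, y ≠ x → y ≠ σ.symm x → T.MDom x y) ∧
  ∀ x : V, ¬ T.MDom x (σ.symm x)

/-- The vertex set of the directed subpath `xCy` of the Hamilton cycle whose
successor permutation is `σ`: all vertices reachable from `x` along the cycle
no later than the first visit of `y`. -/
def PathSet (σ : Equiv.Perm V) (x y : V) : Set V :=
  {z | ∃ k : ℕ, (⇑σ)^[k] x = z ∧ ∀ j < k, (⇑σ)^[j] x ≠ y}

/-- `R^+(x)`: the vertices to which `x` sends a red edge. -/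
def Rplus (x : V) : Set V := {v | T.beats x v ∧ T.colour x v = red}
/-- `R^-(x)`: the vertices from which `x` receives a red edge. -/
def Rminus (x : V) : Set V := {v | T.beats v x ∧ T.colour v x = red}
/-- `B^+(x)`: the vertices to which `x` sends a blue edge. -/
def Bplus (x : V) : Set V := {v | T.beats x v ∧ T.colour x v = blue}
/-- `B^-(x)`: the vertices from which `x` receives a blue edge. -/
def Bminus (x : V) : Set V := {v | T.beats v x ∧ T.colour v x = blue}
/-- `R_r^+(x) = {v ∈ R^+(x) : v monochromatically dominates x in red}`. -/
def Rrplus (x : V) : Set V := {v ∈ T.Rplus x | T.Dom red v x}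
/-- `R_r^-(x) = {v ∈ R^-(x) : x monochromatically dominates v in red}`. -/
def Rrminus (x : V) : Set V := {v ∈ T.Rminus x | T.Dom red x v}
/-- `B_b^+(x) = {v ∈ B^+(x) : v monochromatically dominates x in blue}`. -/
def Bbplus (x : V) : Set V := {v ∈ T.Bplus x | T.Dom blue v x}
/-- `B_b^-(x) = {v ∈ B^-(x) : x monochromatically dominates v in blue}`. -/
def Bbminus (x : V) : Set V := {v ∈ T.Bminus x | T.Dom blue x v}

end CTournament

namespace CTournament

theorem colour_cases (c : Fin 3) : c = red ∨ c = blue ∨ c = green := by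
  revert c; decide

section
variable {V : Type*} {T : CTournament V}

/-- A closed walk gives an out-neighbour on it. -/
theorem cyc_head {c : Fin 3} {x : V} (hc : T.Dom c x x) :
    ∃ a, T.beats x a ∧ T.colour x a = c ∧ T.Dom c a x := by
  obtain ⟨a, h1, h2⟩ := Relation.TransGen.head'_iff.1 hc
  rcases Relation.reflTransGen_iff_eq_or_transGen.1 h2 with h3 | h3
  · subst h3; exact absurd h1.1 (T.irrefl _)
  · exact ⟨a, h1.1, h1.2, h3⟩

/-- A closed walk gives an in-neighbour on it. -/
theorem cyc_tail {c : Fin 3} {x : V} (hc : T.Dom c x x) :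
    ∃ a, T.beats a x ∧ T.colour a x = c ∧ T.Dom c x a := by
  obtain ⟨a, h1, h2⟩ := Relation.TransGen.tail'_iff.1 hc
  rcases Relation.reflTransGen_iff_eq_or_transGen.1 h1 with h3 | h3
  · subst h3; exact absurd h2.1 (T.irrefl _)
  · exact ⟨a, h2.1, h2.2, h3⟩

theorem out_colour {x : V} (hx : ¬ T.IncidentColour x green) {v : V} (hv : T.MDom x v) :
    T.Dom red x v ∨ T.Dom blue x v := by
  obtain ⟨c, hc⟩ := hv
  rcases colour_cases c with rfl | rfl | rfl
  · exact Or.inl hc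
  · exact Or.inr hc
  · obtain ⟨a, h1, -⟩ := Relation.TransGen.head'_iff.1 hc
    exact absurd ⟨a, Or.inl h1⟩ hx

theorem in_colour {x : V} (hx : ¬ T.IncidentColour x green) {v : V} (hv : T.MDom v x) :
    T.Dom red v x ∨ T.Dom blue v x := by
  obtain ⟨c, hc⟩ := hv
  rcases colour_cases c with rfl | rfl | rfl
  · exact Or.inl hc
  · exact Or.inr hc
  · obtain ⟨a, -, h1⟩ := Relation.TransGen.tail'_iff.1 hc
    exact absurd ⟨a, Or.inr h1⟩ hx

/-- A walk from a set to its complement has an edge leaving the set. -/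
theorem crossing {r : V → V → Prop} (S : Set V) {u v : V} (hr : Relation.TransGen r u v)
    (hu : u ∈ S) (hv : v ∉ S) : ∃ a b, a ∈ S ∧ b ∉ S ∧ r a b := by
  induction hr with
  | single hab => exact ⟨_, _, hu, hv, hab⟩
  | @tail b c _ h2 ih =>
    by_cases hb : b ∈ S
    · exact ⟨b, c, hb, hv, h2⟩
    · exact ih hb

variable {σ : Equiv.Perm V} {x : V}

theorem step_excl (hprop : T.HamDomProp σ) {c : Fin 3} {v : V}
    (h1 : T.Dom c x v) (h2 : T.Dom c (σ v) x) : False :=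
  hprop.2 (σ v) ⟨c, by rw [Equiv.symm_apply_apply]; exact h2.trans h1⟩

theorem exclI (hprop : T.HamDomProp σ) (hx : ¬ T.IncidentColour x green) {v : V}
    (hvx : v ≠ x) (h1 : T.Dom red x v) (h2 : T.Dom blue x v) : False := by
  by_cases hv : σ v = x
  · exact hprop.2 x ⟨red, by rw [← hv, Equiv.symm_apply_apply, hv]; exact h1⟩
  · have := hprop.1 (σ v) x (Ne.symm hv) (by simpa using hvx.symm)
    rcases in_colour hx this with h | h
    · exact step_excl hprop h1 h
    · exact step_excl hprop h2 h

theorem exclO (hprop : T.HamDomProp σ) (hx : ¬ T.IncidentColour x green) {v : V}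
    (hvx : v ≠ x) (h1 : T.Dom red v x) (h2 : T.Dom blue v x) : False := by
  by_cases hv : σ.symm v = x
  · exact hprop.2 v ⟨red, by rw [hv]; exact h1⟩
  · have := hprop.1 x (σ.symm v) hv (by simpa using hvx)
    rcases out_colour hx this with h | h
    · exact step_excl hprop h (by simpa using h1)
    · exact step_excl hprop h (by simpa using h2)

/-- The vertices along the cycle starting from `x`, indexed by `0, …, m - 1`. -/
theorem cycle_index [Fintype V] (hσ : T.IsHamCycle σ) (x : V) :
    ∃ (m : ℕ) (f : ℕ → V), 3 ≤ m ∧ f 0 = x ∧ (∀ i, f (i + 1) = σ (f i)) ∧ f m = x ∧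
      (∀ i j, i < m → j < m → f i = f j → i = j) ∧ ∀ v, ∃ i < m, f i = v := by
  have hper : x ∈ Function.periodicPts σ := by
    obtain ⟨n, hn⟩ := hσ.2 (σ x) x
    exact ⟨n + 1, Nat.succ_pos _, hn⟩
  have hpos := Function.minimalPeriod_pos_of_mem_periodicPts hper
  have hm : σ^[Function.minimalPeriod σ x] x = x := Function.isPeriodicPt_minimalPeriod σ x
  refine ⟨Function.minimalPeriod σ x, fun i => σ^[i] x, ?_, rfl,
    fun i => Function.iterate_succ_apply' _ _ _, hm, ?_, ?_⟩
  · by_contra hlt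
    have : Function.minimalPeriod σ x = 1 ∨ Function.minimalPeriod σ x = 2 := by omega
    rcases this with h | h
    · rw [h] at hm
      have := hσ.1 x
      rw [show σ x = x from hm] at this
      exact T.irrefl _ this
    · rw [h] at hm
      have h2 := hσ.1 (σ x)
      rw [show σ (σ x) = x from hm] at h2
      exact T.asymm _ _ (hσ.1 x) h2
  · intro i j hi hj hij
    exact (Function.iterate_injOn_Iio_minimalPeriod (f := σ) (x := x)) hi hj hij
  · intro v
    obtain ⟨n, hn⟩ := hσ.2 x v
    exact ⟨n % Function.minimalPeriod σ x, Nat.mod_lt _ hpos, by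
      simp only [Function.iterate_mod_minimalPeriod_eq, hn]⟩

end

/-- There is a red closed walk through `x`. -/
theorem red_cycle {V : Type*} [Fintype V] (T : CTournament V)
    (h : ¬ T.HasT3) (σ : Equiv.Perm V)
    (hσ : T.IsHamCycle σ) (hprop : T.HamDomProp σ)
    (x : V) (hx : ¬ T.IncidentColour x green)
    (hpred : T.beats (σ.symm x) x) (hpredred : T.colour (σ.symm x) x = red) :
    T.Dom red x x := by
  by_contra hno
  obtain ⟨m, f, hm, h0, hs, hfm, hinj, hsurj⟩ := cycle_index hσ x
  have hfl : f (m - 1) = σ.symm x := by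
    rw [Equiv.eq_symm_apply, ← hs, show m - 1 + 1 = m by omega, hfm]
  have hfx : ∀ i, 1 ≤ i → i < m → f i ≠ x := fun i h1 h2 h3 => by
    have := hinj i 0 h2 (by omega) (h3.trans h0.symm); omega
  have hfp : ∀ i, i < m - 1 → f i ≠ σ.symm x := fun i h1 h2 => by
    have := hinj i (m - 1) (by omega) (by omega) (h2.trans hfl.symm); omega
  have hI : ∀ i, 1 ≤ i → i < m - 1 → T.Dom red x (f i) ∨ T.Dom blue x (f i) :=
    fun i h1 h2 => out_colour hx (hprop.1 _ _ (hfx i h1 (by omega)) (hfp i h2))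
  have hO : ∀ i, 2 ≤ i → i < m → T.Dom red (f i) x ∨ T.Dom blue (f i) x := fun i h1 h2 =>
    in_colour hx (hprop.1 _ _ (hfx i (by omega) h2).symm (by
      obtain ⟨k, rfl⟩ : ∃ k, i = k + 1 := ⟨i - 1, by omega⟩
      rw [hs, Equiv.symm_apply_apply]; exact (hfx k (by omega) (by omega)).symm))
  have hst : ∀ c i, T.Dom c x (f i) → T.Dom c (f (i + 1)) x → False := fun c i h1 h2 =>
    step_excl hprop h1 (by rw [← hs]; exact h2)
  have hIl : ∀ c, ¬ T.Dom c x (f (m - 1)) := fun c hc => hprop.2 x ⟨c, hfl ▸ hc⟩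
  have hO1 : ∀ c, ¬ T.Dom c (f 1) x := fun c hc => hprop.2 (f 1) ⟨c, by
    rw [hs 0, Equiv.symm_apply_apply, h0, ← h0, ← hs 0, h0]; exact hc⟩
  have hOl : T.Dom red (f (m - 1)) x := by
    rw [hfl]; exact Relation.TransGen.single ⟨hpred, hpredred⟩
  have hnK : ∀ i, T.Dom red x (f i) → T.Dom red (f i) x → False := fun i h1 h2 =>
    hno (h1.trans h2)
  -- at most one vertex is on a blue closed walk with `x`
  have huniq : ∀ i j, 1 ≤ i → i < j → j < m → T.Dom blue x (f i) → T.Dom blue (f i) x →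
      T.Dom blue (f j) x → False := by
    intro i j hi hij hjm h1 h1' h2
    have hi2 : i ≠ 1 := by rintro rfl; exact hO1 _ h1'
    have key : ∀ d, d < j - i → T.Dom blue (f (j - d)) x := by
      intro d
      induction d with
      | zero => intro _; exact h2
      | succ d ih =>
        intro hd
        have h3 := ih (by omega)
        have h4 : ¬ T.Dom blue x (f (j - (d + 1))) := fun h4 =>
          hst _ _ h4 (by rw [show j - (d + 1) + 1 = j - d by omega]; exact h3)
        have h5 := (hI (j - (d + 1)) (by omega) (by omega)).resolve_right h4
        exact (hO (j - (d + 1)) (by omega) (by omega)).resolve_left (hnK _ h5)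
    have := key (j - i - 1) (by omega)
    exact hst _ i h1 (by rw [show i + 1 = j - (j - i - 1) by omega]; exact this)
  have hnb : ¬ T.Dom blue x x := by
    intro hb
    obtain ⟨a, ha1, ha2, ha3⟩ := cyc_head hb
    obtain ⟨d, hd1, hd2, hd3⟩ := cyc_tail hb
    have ha4 : T.Dom blue x a := Relation.TransGen.single ⟨ha1, ha2⟩
    have hd4 : T.Dom blue d x := Relation.TransGen.single ⟨hd1, hd2⟩
    obtain ⟨i, hi, rfl⟩ := hsurj a
    obtain ⟨j, hj, rfl⟩ := hsurj d
    have hi0 : i ≠ 0 := by rintro rfl; rw [h0] at ha1; exact T.irrefl _ ha1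
    have hj0 : j ≠ 0 := by rintro rfl; rw [h0] at hd1; exact T.irrefl _ hd1
    rcases lt_trichotomy i j with hij | hij | hij
    · exact huniq i j (by omega) hij hj ha4 ha3 hd4
    · subst hij; exact T.asymm _ _ ha1 hd1
    · exact huniq j i (by omega) hij hi hd3 hd4 ha3
  have hnR : ∀ i, 1 ≤ i → i < m → ¬ T.Dom red x (f i) := by
    intro i hi him hr
    have key : ∀ d, i + d < m → T.Dom red x (f (i + d)) := by
      intro d
      induction d with
      | zero => intro _; exact hr
      | succ d ih =>
        intro hd
        have h1 := ih (by omega)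
        have h2 : ¬ T.Dom red (f (i + d + 1)) x := fun h2 => hst _ _ h1 h2
        have h3 := (hO (i + d + 1) (by omega) (by omega)).resolve_left h2
        have h4 : i + d + 1 ≠ m - 1 := fun h4 => h2 (h4 ▸ hOl)
        exact (hI (i + d + 1) (by omega) (by omega)).resolve_right
          fun h5 => hnb (h5.trans h3)
    have := key (m - 1 - i) (by omega)
    rw [show i + (m - 1 - i) = m - 1 by omega] at this
    exact hIl _ this
  have hnB : ∀ i, 1 ≤ i → i < m → ¬ T.Dom blue (f i) x := by
    intro i hi him hb
    by_cases h1 : i = 1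
    · subst h1; exact hO1 _ hb
    · rcases hI (i - 1) (by omega) (by omega) with h2 | h2
      · exact hnR _ (by omega) (by omega) h2
      · exact hst _ _ h2 (by rw [show i - 1 + 1 = i by omega]; exact hb)
  -- every vertex other than `x` is in `B⁺ ∪ R⁻`
  have hBR : ∀ v, v ≠ x → v ∈ T.Bplus x ∨ v ∈ T.Rminus x := by
    intro v hv
    obtain ⟨i, hi, rfl⟩ := hsurj v
    have hi0 : i ≠ 0 := by rintro rfl; exact hv h0
    rcases T.total _ _ hv with hb | hb
    · rcases colour_cases (T.colour (f i) x) with hc | hc | hc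
      · exact Or.inr ⟨hb, hc⟩
      · exact absurd (Relation.TransGen.single ⟨hb, hc⟩) (hnB i (by omega) hi)
      · exact absurd ⟨f i, Or.inr ⟨hb, hc⟩⟩ hx
    · rcases colour_cases (T.colour x (f i)) with hc | hc | hc
      · exact absurd (Relation.TransGen.single ⟨hb, hc⟩) (hnR i (by omega) hi)
      · exact Or.inl ⟨hb, hc⟩
      · exact absurd ⟨f i, Or.inl ⟨hb, hc⟩⟩ hx
  have hb1 : T.Dom blue x (f 1) :=
    (hI 1 le_rfl (by omega)).resolve_left (hnR 1 le_rfl (by omega))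
  obtain ⟨c, hc⟩ := hprop.1 (f 1) (f (m - 1))
    (fun he => by have := hinj _ _ (by omega) (by omega) he; omega)
    (by rw [hs 0, Equiv.symm_apply_apply, h0]; exact hfx _ (by omega) (by omega))
  rcases colour_cases c with rfl | rfl | rfl
  · exact hO1 _ (hc.trans hOl)
  · exact hIl _ (hb1.trans hc)
  · have hf1 : f 1 ∈ T.Bplus x := by
      refine (hBR _ (hfx 1 le_rfl (by omega))).resolve_right fun h1 => ?_
      exact hO1 _ (Relation.TransGen.single h1)
    obtain ⟨a, b, ha, hb, hab⟩ := crossing (T.Bplus x) hc hf1 fun h1 =>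
      hIl _ (Relation.TransGen.single h1)
    by_cases hbx : b = x
    · subst hbx; exact hx ⟨a, Or.inr hab⟩
    · have hb' := (hBR b hbx).resolve_left hb
      refine h ⟨x, a, b, ha.1, hab.1, hb'.1, ?_, ?_, ?_⟩
      · rw [ha.2, hab.2]; decide
      · rw [hb'.2, hab.2]; decide
      · rw [ha.2, hb'.2]; decide

end CTournament

open CTournament in
/-- In a minimal counterexample with Hamilton cycle `σ`, if `x`
is incident with no green edge and the edge from `x⁻` to `x` is red, then the sets
`R_r⁺(x)` and `R_r⁻(x)` are both nonempty, and moreover some vertex of `R_r⁻(x)`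
has its successor on the cycle outside `B⁺(x)`. -/
theorem Rrplus_Rrminus_nonempty {V : Type*} [Fintype V] (T : CTournament V)
    (h : T.MinimalCex) (σ : Equiv.Perm V)
    (hσ : T.IsHamCycle σ) (hprop : T.HamDomProp σ)
    (x : V) (hx : ¬ T.IncidentColour x CTournament.green)
    (hpred : T.beats (σ.symm x) x)
    (hpredred : T.colour (σ.symm x) x = CTournament.red) :
    (T.Rrplus x).Nonempty ∧ (T.Rrminus x).Nonempty ∧
      ∃ n ∈ T.Rrminus x, σ n ∉ T.Bplus x := by
  have hcyc := red_cycle T h.1 σ hσ hprop x hx hpred hpredred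
  obtain ⟨a, ha1, ha2, ha3⟩ := cyc_head hcyc
  obtain ⟨n, hn1, hn2, hn3⟩ := cyc_tail hcyc
  have ha4 : T.Dom red x a := Relation.TransGen.single ⟨ha1, ha2⟩
  have hn4 : T.Dom red n x := Relation.TransGen.single ⟨hn1, hn2⟩
  refine ⟨⟨a, ⟨ha1, ha2⟩, ha3⟩, ⟨n, ⟨hn1, hn2⟩, hn3⟩, n, ⟨⟨hn1, hn2⟩, hn3⟩, fun hc => ?_⟩
  have hax : a ≠ x := by rintro rfl; exact T.irrefl _ ha1
  have hnx : n ≠ x := by rintro rfl; exact T.irrefl _ hn1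
  have han : a ≠ n := by rintro rfl; exact T.asymm _ _ ha1 hn1
  have hcx : σ n ≠ x := fun he => by rw [he] at hc; exact T.irrefl _ hc.1
  have hc1 : T.Dom blue x (σ n) := Relation.TransGen.single hc
  have hc2 : T.Dom blue (σ n) x :=
    (in_colour hx (hprop.1 (σ n) x hcx.symm (by simpa using hnx.symm))).resolve_left
      fun h1 => step_excl hprop hn3 h1
  -- dominations between the two classes are green
  have hBR : ∀ u v, u ≠ x → v ≠ x → T.Dom blue x u → T.Dom blue u x → T.Dom red x v →
      T.Dom red v x → v ≠ σ.symm u → T.Dom green u v := by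
    intro u v hu hv h1 h2 h3 h4 h5
    obtain ⟨c, hc⟩ := hprop.1 u v (by rintro rfl; exact exclI hprop hx hv h3 h1) h5
    rcases colour_cases c with rfl | rfl | rfl
    · exact (exclO hprop hx hu (hc.trans h4) h2).elim
    · exact (exclI hprop hx hv h3 (h1.trans hc)).elim
    · exact hc
  have hRB : ∀ v u, u ≠ x → v ≠ x → T.Dom blue x u → T.Dom blue u x → T.Dom red x v →
      T.Dom red v x → u ≠ σ.symm v → T.Dom green v u := by
    intro v u hu hv h1 h2 h3 h4 h5
    obtain ⟨c, hc⟩ := hprop.1 v u (by rintro rfl; exact exclI hprop hx hv h3 h1) h5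
    rcases colour_cases c with rfl | rfl | rfl
    · exact (exclI hprop hx hu (h3.trans hc) h1).elim
    · exact (exclO hprop hx hv h4 (hc.trans h2)).elim
    · exact hc
  have hca : T.Dom green (σ n) a :=
    hBR _ _ hcx hax hc1 hc2 ha4 ha3 (by simpa using han)
  have key : ∀ e, e ≠ x → T.Dom blue x e → T.Dom blue e x → e ≠ σ n → σ e = a := by
    intro e he h1 h2 h3
    by_contra h4
    have h5 : T.Dom green a e := hRB _ _ he hax h1 h2 ha4 ha3
      (fun h5 => h4 (by rw [h5, Equiv.apply_symm_apply]))
    have h6 : T.Dom green e n := hBR _ _ he hnx h1 h2 hn3 hn4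
      (fun h6 => h3 (by rw [h6, Equiv.apply_symm_apply]))
    exact hprop.2 (σ n) ⟨green, by
      rw [Equiv.symm_apply_apply]; exact (hca.trans h5).trans h6⟩
  obtain ⟨d, hd1, hd2, hd3⟩ := cyc_tail (hc1.trans hc2)
  have hdx : d ≠ x := by rintro rfl; exact T.irrefl _ hd1
  have hda : σ d = a := key d hdx hd3 (Relation.TransGen.single ⟨hd1, hd2⟩)
    (by rintro rfl; exact T.asymm _ _ hc.1 hd1)
  obtain ⟨m, f, hm, h0, hs, hfm, hinj, hsurj⟩ := cycle_index hσ x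
  have hfl : f (m - 1) = σ.symm x := by
    rw [Equiv.eq_symm_apply, ← hs, show m - 1 + 1 = m by omega, hfm]
  have hfx : ∀ i, 1 ≤ i → i < m → f i ≠ x := fun i h1 h2 h3 => by
    have := hinj i 0 h2 (by omega) (h3.trans h0.symm); omega
  obtain ⟨p, hp, rfl⟩ := hsurj a
  have hp0 : p ≠ 0 := by rintro rfl; exact hax h0
  -- the first vertex after `a` in the blue class does not exist
  have walk : ∀ k, p + k < m → T.Dom red x (f (p + k)) ∧ (k ≠ 0 → ¬ T.Dom red (f (p + k)) x) := by
    intro k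
    induction k with
    | zero => intro _; exact ⟨ha4, fun h1 => absurd rfl h1⟩
    | succ k ih =>
      intro hk
      obtain ⟨h1, h1'⟩ := ih (by omega)
      have hne : f (p + k + 1) ≠ x := hfx _ (by omega) hk
      have hnr : ¬ T.Dom red (f (p + k + 1)) x := fun h2 =>
        step_excl hprop h1 (by rw [← hs]; exact h2)
      have h2 : T.Dom blue (f (p + k + 1)) x := by
        refine (in_colour hx (hprop.1 _ _ hne.symm ?_)).resolve_left hnr
        rw [hs, Equiv.symm_apply_apply]; exact (hfx _ (by omega) (by omega)).symm
      have hlast : f (p + k + 1) ≠ σ.symm x := fun h3 => hnr (by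
        rw [h3]; exact Relation.TransGen.single ⟨hpred, hpredred⟩)
      rcases out_colour hx (hprop.1 _ _ hne hlast) with h3 | h3
      · exact ⟨h3, fun _ => hnr⟩
      · exfalso
        by_cases h4 : f (p + k + 1) = σ n
        · have h5 : f (p + k) = n := by rw [hs] at h4; exact σ.injective h4
          rcases Nat.eq_zero_or_pos k with rfl | hk0
          · exact han h5
          · exact h1' (by omega) (by rw [h5]; exact hn4)
        · have h5 := key _ hne h3 h2 h4
          rw [← hs] at h5
          by_cases h6 : p + k + 1 + 1 = m
          · rw [h6, hfm] at h5; exact hax h5.symm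
          · have := hinj _ _ (by omega) hp h5; omega
  have := (walk (m - 1 - p) (by omega)).1
  rw [show p + (m - 1 - p) = m - 1 by omega, hfl] at this
  exact hprop.2 x ⟨red, this⟩
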